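/- Let Q = (Q_{i,j}(w,z))_{i,j∈I} satisfy the defining conditions for a quiver Hecke superalgebra, and let (γ_{i,j})_{i,j∈I} be a family of invertible elements of k. Define Q′ = (Q′_{i,j}) by Q′_{i,j}(w,z) = γ_{i,j}γ_{j,i}·Q_{i,j}(γ_{i,i}w, γ_{j,j}z). Then Q′ also satisfies the defining conditions, and the assignment e(ν) ↦ e(ν), x_p e(ν) ↦ γ_{ν_p,ν_p} x_p e(ν), τ_a e(ν) ↦ γ_{ν_a,ν_{a+1}}^{−1} τ_a e(ν) extends to an isomorphism of k-superalgebras R_n(Q) ≅ R_n(Q′). -/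

import Mathlib

/-!
STATEMENT 11 (Remark 3.3 (ii) of Kang–Kashiwara–Tsuchioka): rescaling.  For invertible
scalars `γ_{i,j}`, setting `Q′_{i,j}(w,z) = γ_{i,j}γ_{j,i} Q_{i,j}(γ_{i,i}w, γ_{j,j}z)`,
the family `Q′` again satisfies the defining conditions and
`e(ν) ↦ e(ν)`, `x_p e(ν) ↦ γ_{ν_p,ν_p} x_p e(ν)`,
`τ_a e(ν) ↦ γ_{ν_a,ν_{a+1}}⁻¹ τ_a e(ν)` extends to an isomorphism `R_n(Q) ≅ R_n(Q′)`.
-/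

namespace QuiverHeckeSuper11

/-- position `a` resp. `a+1` in `{1,…,n}` attached to `a ∈ {1,…,n−1}`. -/
def lo {n : ℕ} (a : Fin (n - 1)) : Fin n := ⟨a, by omega⟩
def hi {n : ℕ} (a : Fin (n - 1)) : Fin n := ⟨(a : ℕ) + 1, by omega⟩

/-- The transposition `s_a = (a, a+1)` of `{1, …, n}`. -/
def sperm {n : ℕ} (a : Fin (n - 1)) : Equiv.Perm (Fin n) := Equiv.swap (lo a) (hi a)

variable (k : Type) [CommRing k] (I : Type) [Fintype I] [DecidableEq I]
  (podd : I → Bool)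

/-- The relation defining the skew polynomial algebra
`A^{i,j} = k⟨w,z⟩/(zw − (−1)^{p(i)p(j)} wz)`; the variable `0` is `w`, the variable `1`
is `z`. -/
inductive ARel2 (i j : I) : FreeAlgebra k (Fin 2) → FreeAlgebra k (Fin 2) → Prop
  | comm : ARel2 i j (FreeAlgebra.ι k (1 : Fin 2) * FreeAlgebra.ι k (0 : Fin 2))
      (if podd i ∧ podd j then
        -(FreeAlgebra.ι k (0 : Fin 2) * FreeAlgebra.ι k (1 : Fin 2))
      else FreeAlgebra.ι k (0 : Fin 2) * FreeAlgebra.ι k (1 : Fin 2))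

/-- The skew polynomial algebra `A^{i,j}`. -/
abbrev A2 (i j : I) := RingQuot (ARel2 k I podd i j)

/-- The projection `k⟨w,z⟩ → A^{i,j}`. -/
noncomputable def mkA2 (i j : I) : FreeAlgebra k (Fin 2) →ₐ[k] A2 k I podd i j :=
  RingQuot.mkAlgHom k (ARel2 k I podd i j)

/-- The relations defining the three-variable skew polynomial algebra on variables
`x₀, x₁, x₂` of parities `p(i), p(j), p(i)`. -/
inductive ARel3 (i j : I) : FreeAlgebra k (Fin 3) → FreeAlgebra k (Fin 3) → Prop
  | comm (s t : Fin 3) (h : (s : ℕ) < (t : ℕ)) :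
      ARel3 i j (FreeAlgebra.ι k t * FreeAlgebra.ι k s)
        (if podd (if s = 1 then j else i) ∧ podd (if t = 1 then j else i) then
          -(FreeAlgebra.ι k s * FreeAlgebra.ι k t)
        else FreeAlgebra.ι k s * FreeAlgebra.ι k t)

/-- The three-variable skew polynomial algebra with variable parities `p(i), p(j), p(i)`. -/
abbrev A3 (i j : I) := RingQuot (ARel3 k I podd i j)

noncomputable def mkA3 (i j : I) : FreeAlgebra k (Fin 3) →ₐ[k] A3 k I podd i j :=
  RingQuot.mkAlgHom k (ARel3 k I podd i j)

/-- `(w,z) ↦ (z,w)` on `k⟨w,z⟩`. -/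
noncomputable def swapWZ : FreeAlgebra k (Fin 2) →ₐ[k] FreeAlgebra k (Fin 2) :=
  FreeAlgebra.lift k fun t : Fin 2 => FreeAlgebra.ι k (if t = 0 then (1 : Fin 2) else 0)

/-- `(w,z) ↦ (−w,z)` on `k⟨w,z⟩`. -/
noncomputable def negW : FreeAlgebra k (Fin 2) →ₐ[k] FreeAlgebra k (Fin 2) :=
  FreeAlgebra.lift k fun t : Fin 2 =>
    if t = 0 then -FreeAlgebra.ι k (0 : Fin 2) else FreeAlgebra.ι k (1 : Fin 2)

/-- `Q(w,z) ↦ Q(x₂,x₁)` from `k⟨w,z⟩` to the free algebra in `x₀,x₁,x₂`. -/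
noncomputable def sub21 : FreeAlgebra k (Fin 2) →ₐ[k] FreeAlgebra k (Fin 3) :=
  FreeAlgebra.lift k fun t : Fin 2 => FreeAlgebra.ι k (if t = 0 then (2 : Fin 3) else 1)

/-- `Q(w,z) ↦ Q(x₀,x₁)`. -/
noncomputable def sub01 : FreeAlgebra k (Fin 2) →ₐ[k] FreeAlgebra k (Fin 3) :=
  FreeAlgebra.lift k fun t : Fin 2 => FreeAlgebra.ι k (if t = 0 then (0 : Fin 3) else 1)

/-- The conditions (3.1) on the family `Q = (Q_{i,j})`, expressed on representatives
`Qrep i j ∈ k⟨w,z⟩` of `Q_{i,j} ∈ A^{i,j}`: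
`Q_{i,i} = 0`, `Q_{i,j}(w,z) = Q_{j,i}(z,w)`, and `Q_{i,j}(−w,z) = Q_{i,j}(w,z)` for odd
`i`. -/
structure QConds (Qrep : I → I → FreeAlgebra k (Fin 2)) : Prop where
  diag : ∀ i, mkA2 k I podd i i (Qrep i i) = 0
  symm : ∀ i j, mkA2 k I podd i j (swapWZ k (Qrep j i)) = mkA2 k I podd i j (Qrep i j)
  even : ∀ i j, podd i = true →
    mkA2 k I podd i j (negW k (Qrep i j)) = mkA2 k I podd i j (Qrep i j)

/-- Generators of the quiver Hecke superalgebra `R_n(Q)`. -/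
inductive RGen (I : Type) (n : ℕ) : Type
  | x (p : Fin n)
  | tau (a : Fin (n - 1))
  | e (ν : Fin n → I)

variable (n : ℕ)

abbrev RFree := FreeAlgebra k (RGen I n)

def xF (p : Fin n) : RFree k I n := FreeAlgebra.ι k (RGen.x p)
def tauF (a : Fin (n - 1)) : RFree k I n := FreeAlgebra.ι k (RGen.tau a)
def eF (ν : Fin n → I) : RFree k I n := FreeAlgebra.ι k (RGen.e ν)

/-- Evaluation `Q(w,z) ↦ Q(x_a, x_{a+1})` into the free algebra on the generators of
`R_n(Q)`. -/
noncomputable def evalX (a : Fin (n - 1)) : FreeAlgebra k (Fin 2) →ₐ[k] RFree k I n :=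
  FreeAlgebra.lift k fun t : Fin 2 => if t = 0 then xF k I n (lo a) else xF k I n (hi a)

/-- Evaluation of a three-variable element at `(x_a, x_{a+1}, x_{a+2})`. -/
noncomputable def evalX3 (a b : Fin (n - 1)) : FreeAlgebra k (Fin 3) →ₐ[k] RFree k I n :=
  FreeAlgebra.lift k fun t : Fin 3 =>
    if t = 0 then xF k I n (lo a) else if t = 1 then xF k I n (hi a) else xF k I n (hi b)

/-- The defining relations of the quiver Hecke superalgebra `R_n(Q)`
(Definition 3.2 of Kang–Kashiwara–Tsuchioka), for a family of representatives
`Qrep i j ∈ k⟨w,z⟩` of the `Q_{i,j} ∈ A^{i,j}`. -/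
inductive RRel (Qrep : I → I → FreeAlgebra k (Fin 2)) :
    RFree k I n → RFree k I n → Prop
  /- (i) orthogonal idempotents summing to `1` -/
  | e_orth (μ ν : Fin n → I) (h : μ ≠ ν) : RRel Qrep (eF k I n μ * eF k I n ν) 0
  | e_idem (ν : Fin n → I) : RRel Qrep (eF k I n ν * eF k I n ν) (eF k I n ν)
  | e_sum : RRel Qrep (∑ ν : Fin n → I, eF k I n ν) 1
  | xe (p : Fin n) (ν : Fin n → I) :
      RRel Qrep (xF k I n p * eF k I n ν) (eF k I n ν * xF k I n p)
  | taue (a : Fin (n - 1)) (ν : Fin n → I) :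
      RRel Qrep (tauF k I n a * eF k I n ν)
        (eF k I n (fun p => ν (sperm a p)) * tauF k I n a)
  /- (ii) skew-commutation of the `x`'s -/
  | xx (p q : Fin n) (ν : Fin n → I) :
      RRel Qrep (xF k I n p * xF k I n q * eF k I n ν)
        (if p ≠ q ∧ podd (ν p) ∧ podd (ν q) then
          -(xF k I n q * xF k I n p * eF k I n ν)
        else xF k I n q * xF k I n p * eF k I n ν)
  /- (iii) `τ_a x_p e(ν) = (−1)^{p(ν_p)p(ν_a)p(ν_{a+1})} x_p τ_a e(ν)` for `p ≠ a, a+1` -/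
  | taux (a : Fin (n - 1)) (p : Fin n) (ν : Fin n → I) (h1 : p ≠ lo a) (h2 : p ≠ hi a) :
      RRel Qrep (tauF k I n a * xF k I n p * eF k I n ν)
        (if podd (ν p) ∧ podd (ν (lo a)) ∧ podd (ν (hi a)) then
          -(xF k I n p * tauF k I n a * eF k I n ν)
        else xF k I n p * tauF k I n a * eF k I n ν)
  /- (iv) `(τ_a x_{a+1} − (−1)^{p(ν_a)p(ν_{a+1})} x_a τ_a) e(ν) = δ_{ν_a,ν_{a+1}} e(ν)` … -/
  | taux1 (a : Fin (n - 1)) (ν : Fin n → I) :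
      RRel Qrep
        (tauF k I n a * xF k I n (hi a) * eF k I n ν
          - (if podd (ν (lo a)) ∧ podd (ν (hi a)) then
              -(xF k I n (lo a) * tauF k I n a * eF k I n ν)
            else xF k I n (lo a) * tauF k I n a * eF k I n ν))
        (if ν (lo a) = ν (hi a) then eF k I n ν else 0)
  /- … `= (x_{a+1} τ_a − (−1)^{p(ν_a)p(ν_{a+1})} τ_a x_a) e(ν)` -/
  | taux2 (a : Fin (n - 1)) (ν : Fin n → I) :
      RRel Qrep
        (xF k I n (hi a) * tauF k I n a * eF k I n ν
          - (if podd (ν (lo a)) ∧ podd (ν (hi a)) then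
              -(tauF k I n a * xF k I n (lo a) * eF k I n ν)
            else tauF k I n a * xF k I n (lo a) * eF k I n ν))
        (if ν (lo a) = ν (hi a) then eF k I n ν else 0)
  /- (v) `τ_a² e(ν) = Q_{ν_a,ν_{a+1}}(x_a, x_{a+1}) e(ν)` -/
  | tausq (a : Fin (n - 1)) (ν : Fin n → I) :
      RRel Qrep (tauF k I n a * tauF k I n a * eF k I n ν)
        (evalX k I n a (Qrep (ν (lo a)) (ν (hi a))) * eF k I n ν)
  /- (vi) `τ_a τ_b e(ν) = (−1)^{…} τ_b τ_a e(ν)` for `|a − b| > 1` -/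
  | tautau (a b : Fin (n - 1)) (ν : Fin n → I)
      (h : (a : ℕ) + 1 < (b : ℕ) ∨ (b : ℕ) + 1 < (a : ℕ)) :
      RRel Qrep (tauF k I n a * tauF k I n b * eF k I n ν)
        (if podd (ν (lo a)) ∧ podd (ν (hi a)) ∧ podd (ν (lo b)) ∧ podd (ν (hi b)) then
          -(tauF k I n b * tauF k I n a * eF k I n ν)
        else tauF k I n b * tauF k I n a * eF k I n ν)
  /- (vii) the braid-deformation relation, even case: `D` is the divided difference
     `(Q(x_{a+2},x_{a+1}) − Q(x_a,x_{a+1}))/(x_{a+2} − x_a)` -/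
  | braid_even (a b : Fin (n - 1)) (hab : (b : ℕ) = (a : ℕ) + 1) (ν : Fin n → I)
      (hsame : ν (lo a) = ν (hi b)) (hev : podd (ν (lo a)) = false)
      (D : FreeAlgebra k (Fin 3))
      (hD : mkA3 k I podd (ν (lo a)) (ν (hi a))
              (D * (FreeAlgebra.ι k (2 : Fin 3) - FreeAlgebra.ι k (0 : Fin 3))) =
            mkA3 k I podd (ν (lo a)) (ν (hi a))
              (sub21 k (Qrep (ν (lo a)) (ν (hi a))) - sub01 k (Qrep (ν (lo a)) (ν (hi a))))) :
      RRel Qrep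
        (tauF k I n b * tauF k I n a * tauF k I n b * eF k I n ν
          - tauF k I n a * tauF k I n b * tauF k I n a * eF k I n ν)
        (evalX3 k I n a b D * eF k I n ν)
  /- (vii) odd case: `D = (Q(x_{a+2},x_{a+1}) − Q(x_a,x_{a+1}))/(x_{a+2}² − x_a²)` -/
  | braid_odd (a b : Fin (n - 1)) (hab : (b : ℕ) = (a : ℕ) + 1) (ν : Fin n → I)
      (hsame : ν (lo a) = ν (hi b)) (hodd : podd (ν (lo a)) = true)
      (D : FreeAlgebra k (Fin 3))
      (hD : mkA3 k I podd (ν (lo a)) (ν (hi a))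
              (D * (FreeAlgebra.ι k (2 : Fin 3) * FreeAlgebra.ι k (2 : Fin 3)
                     - FreeAlgebra.ι k (0 : Fin 3) * FreeAlgebra.ι k (0 : Fin 3))) =
            mkA3 k I podd (ν (lo a)) (ν (hi a))
              (sub21 k (Qrep (ν (lo a)) (ν (hi a))) - sub01 k (Qrep (ν (lo a)) (ν (hi a))))) :
      RRel Qrep
        (tauF k I n b * tauF k I n a * tauF k I n b * eF k I n ν
          - tauF k I n a * tauF k I n b * tauF k I n a * eF k I n ν)
        (if podd (ν (hi a)) then
          -((xF k I n (hi b) - xF k I n (lo a)) * evalX3 k I n a b D * eF k I n ν)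
        else (xF k I n (hi b) - xF k I n (lo a)) * evalX3 k I n a b D * eF k I n ν)
  /- (vii) the remaining case -/
  | braid_zero (a b : Fin (n - 1)) (hab : (b : ℕ) = (a : ℕ) + 1) (ν : Fin n → I)
      (hdiff : ν (lo a) ≠ ν (hi b)) :
      RRel Qrep
        (tauF k I n b * tauF k I n a * tauF k I n b * eF k I n ν
          - tauF k I n a * tauF k I n b * tauF k I n a * eF k I n ν) 0

/-- The quiver Hecke superalgebra `R_n(Q)`. -/
abbrev R (Qrep : I → I → FreeAlgebra k (Fin 2)) := RingQuot (RRel k I podd n Qrep)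

noncomputable def xR (Qrep : I → I → FreeAlgebra k (Fin 2)) (p : Fin n) :
    R k I podd n Qrep :=
  RingQuot.mkAlgHom k (RRel k I podd n Qrep) (xF k I n p)
noncomputable def tauR (Qrep : I → I → FreeAlgebra k (Fin 2)) (a : Fin (n - 1)) :
    R k I podd n Qrep :=
  RingQuot.mkAlgHom k (RRel k I podd n Qrep) (tauF k I n a)
noncomputable def eR (Qrep : I → I → FreeAlgebra k (Fin 2)) (ν : Fin n → I) :
    R k I podd n Qrep :=
  RingQuot.mkAlgHom k (RRel k I podd n Qrep) (eF k I n ν)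

/-- `(w,z) ↦ (αw, βz)` on `k⟨w,z⟩`. -/
noncomputable def scaleWZ (α β : k) : FreeAlgebra k (Fin 2) →ₐ[k] FreeAlgebra k (Fin 2) :=
  FreeAlgebra.lift k fun t : Fin 2 =>
    if t = 0 then α • FreeAlgebra.ι k (0 : Fin 2) else β • FreeAlgebra.ι k (1 : Fin 2)

/-- `Q′_{i,j}(w,z) = γ_{i,j} γ_{j,i} ⋅ Q_{i,j}(γ_{i,i} w, γ_{j,j} z)`. -/
noncomputable def Qrep' (Qrep : I → I → FreeAlgebra k (Fin 2)) (γ : I → I → k) (i j : I) :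
    FreeAlgebra k (Fin 2) :=
  (γ i j * γ j i) • scaleWZ k (γ i i) (γ j j) (Qrep i j)

section Scaling

variable {k}

/-- The substitution `X_t ↦ c_t X_t` on a free algebra. -/
noncomputable def scaleVars {X : Type} (c : X → k) : FreeAlgebra k X →ₐ[k] FreeAlgebra k X :=
  FreeAlgebra.lift k fun t => c t • FreeAlgebra.ι k t

@[simp]
theorem scaleVars_ι {X : Type} (c : X → k) (t : X) :
    scaleVars c (FreeAlgebra.ι k t) = c t • FreeAlgebra.ι k t := by
  simp [scaleVars]

theorem scaleWZ_eq_scaleVars (c : Fin 2 → k) : scaleWZ k (c 0) (c 1) = scaleVars c := by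
  ext t
  fin_cases t <;> simp [scaleWZ]

theorem scaleWZ_scaleWZ_of_mul_eq_one {α β α' β' : k} (hα : α * α' = 1) (hβ : β * β' = 1)
    (u : FreeAlgebra k (Fin 2)) : scaleWZ k α' β' (scaleWZ k α β u) = u := by
  have h : (scaleWZ k α' β').comp (scaleWZ k α β) = AlgHom.id k _ := by
    ext t
    fin_cases t <;> simp [scaleWZ, smul_smul, hα, hβ]
  exact DFunLike.congr_fun h u

theorem swapWZ_scaleWZ (α β : k) (u : FreeAlgebra k (Fin 2)) :
    swapWZ k (scaleWZ k α β u) = scaleWZ k β α (swapWZ k u) := by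
  have h : (swapWZ k).comp (scaleWZ k α β) = (scaleWZ k β α).comp (swapWZ k) := by
    ext t
    fin_cases t <;> simp [scaleWZ, swapWZ]
  exact DFunLike.congr_fun h u

theorem negW_scaleWZ (α β : k) (u : FreeAlgebra k (Fin 2)) :
    negW k (scaleWZ k α β u) = scaleWZ k α β (negW k u) := by
  have h : (negW k).comp (scaleWZ k α β) = (scaleWZ k α β).comp (negW k) := by
    ext t
    fin_cases t <;> simp [scaleWZ, negW]
  exact DFunLike.congr_fun h u

theorem sub21_scaleWZ (c : Fin 3 → k) (u : FreeAlgebra k (Fin 2)) :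
    sub21 k (scaleWZ k (c 2) (c 1) u) = scaleVars c (sub21 k u) := by
  have h : (sub21 k).comp (scaleWZ k (c 2) (c 1)) = (scaleVars c).comp (sub21 k) := by
    ext t
    fin_cases t <;> simp [scaleWZ, sub21]
  exact DFunLike.congr_fun h u

theorem sub01_scaleWZ (c : Fin 3 → k) (u : FreeAlgebra k (Fin 2)) :
    sub01 k (scaleWZ k (c 0) (c 1) u) = scaleVars c (sub01 k u) := by
  have h : (sub01 k).comp (scaleWZ k (c 0) (c 1)) = (scaleVars c).comp (sub01 k) := by
    ext t
    fin_cases t <;> simp [scaleWZ, sub01]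
  exact DFunLike.congr_fun h u

variable {J : Type} {odd : J → Bool}

/-- Rescaling the variables descends to any quotient in which the images of the defining
relations hold. -/
theorem mkAlgHom_scaleVars_congr {X : Type} {r : FreeAlgebra k X → FreeAlgebra k X → Prop}
    (c : X → k)
    (hr : ∀ u v, r u v →
      RingQuot.mkAlgHom k r (scaleVars c u) = RingQuot.mkAlgHom k r (scaleVars c v))
    {u v : FreeAlgebra k X} (h : RingQuot.mkAlgHom k r u = RingQuot.mkAlgHom k r v) :
    RingQuot.mkAlgHom k r (scaleVars c u) = RingQuot.mkAlgHom k r (scaleVars c v) := by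
  let L := RingQuot.liftAlgHom k
    ⟨(RingQuot.mkAlgHom k r).comp (scaleVars c), fun {x y} hxy => hr x y hxy⟩
  have hL : ∀ w, L (RingQuot.mkAlgHom k r w) = RingQuot.mkAlgHom k r (scaleVars c w) :=
    fun w => RingQuot.liftAlgHom_mkAlgHom_apply k _ _ w
  rw [← hL, ← hL, h]

theorem mkA2_scaleVars_congr {i j : J} (c : Fin 2 → k) {u v : FreeAlgebra k (Fin 2)}
    (h : mkA2 k J odd i j u = mkA2 k J odd i j v) :
    mkA2 k J odd i j (scaleVars c u) = mkA2 k J odd i j (scaleVars c v) := by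
  refine mkAlgHom_scaleVars_congr c (fun u v huv => ?_) h
  cases huv
  have hrel := RingQuot.mkAlgHom_rel k (ARel2.comm (k := k) (podd := odd) (i := i) (j := j))
  split_ifs at hrel ⊢ <;>
    simp only [map_mul, map_neg, map_smul, scaleVars_ι, smul_mul_assoc, mul_smul_comm] at hrel ⊢ <;>
    rw [hrel, smul_comm]
  simp only [smul_neg]

theorem mkA2_scaleWZ_congr {i j : J} (α β : k) {u v : FreeAlgebra k (Fin 2)}
    (h : mkA2 k J odd i j u = mkA2 k J odd i j v) :
    mkA2 k J odd i j (scaleWZ k α β u) = mkA2 k J odd i j (scaleWZ k α β v) := by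
  simpa [← scaleWZ_eq_scaleVars] using mkA2_scaleVars_congr ![α, β] h

theorem mkA3_scaleVars_congr {i j : J} (c : Fin 3 → k) {u v : FreeAlgebra k (Fin 3)}
    (h : mkA3 k J odd i j u = mkA3 k J odd i j v) :
    mkA3 k J odd i j (scaleVars c u) = mkA3 k J odd i j (scaleVars c v) := by
  refine mkAlgHom_scaleVars_congr c (fun u v huv => ?_) h
  obtain ⟨s, t, hst⟩ := huv
  have hrel := RingQuot.mkAlgHom_rel k
    (ARel3.comm (k := k) (podd := odd) (i := i) (j := j) s t hst)
  split_ifs at hrel ⊢ <;>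
    simp only [map_mul, map_neg, map_smul, scaleVars_ι, smul_mul_assoc, mul_smul_comm] at hrel ⊢ <;>
    rw [hrel, smul_comm] <;> simp only [smul_neg]

/-- If `D` is a divided difference of `Q_{i,j}` with denominator `d` and rescaling multiplies `d`
by `r`, then `γ_{i,j} γ_{j,i} r D(γ_{i,i}x₀, γ_{j,j}x₁, γ_{i,i}x₂)` is one of `Q'_{i,j}`. -/
theorem mkA3_dividedDifference {Q : J → J → FreeAlgebra k (Fin 2)} {γ : J → J → k} {i j : J}
    {c : Fin 3 → k} (h0 : c 0 = γ i i) (h1 : c 1 = γ j j) (h2 : c 2 = γ i i)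
    {D d : FreeAlgebra k (Fin 3)} {r : k} (hd : scaleVars c d = r • d)
    (hD : mkA3 k J odd i j (D * d) = mkA3 k J odd i j (sub21 k (Q i j) - sub01 k (Q i j))) :
    mkA3 k J odd i j (((γ i j * γ j i * r) • scaleVars c D) * d) =
      mkA3 k J odd i j (sub21 k (Qrep' k J Q γ i j) - sub01 k (Qrep' k J Q γ i j)) := by
  have h21 := sub21_scaleWZ c (Q i j)
  have h01 := sub01_scaleWZ c (Q i j)
  rw [h2, h1] at h21
  rw [h0, h1] at h01
  rw [Qrep', map_smul, map_smul, h21, h01, ← smul_sub, ← map_sub (scaleVars c), map_smul,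
    ← mkA3_scaleVars_congr c hD, map_mul (scaleVars c), hd, mul_smul_comm, map_smul,
    smul_mul_assoc, map_smul, smul_smul]

/-- The scalars produced by the three crossings of weights `i, j, i` cancel. -/
theorem braid_scalar {γ γinv : J → J → k} (hγ : ∀ i j, γ i j * γinv i j = 1) (i j : J) :
    γinv i j * γinv i i * γinv j i * (γ i j * γ j i * γ i i) = 1 := by
  linear_combination (γ j i * γinv j i) * (γ i i * γinv i i) * hγ i j +
    (γ i i * γinv i i) * hγ j i + hγ i i

theorem QConds.rescale {Q : J → J → FreeAlgebra k (Fin 2)} (hQ : QConds k J odd Q)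
    (γ : J → J → k) : QConds k J odd (Qrep' k J Q γ) where
  diag i := by
    have h := mkA2_scaleWZ_congr (γ i i) (γ i i) ((hQ.diag i).trans (map_zero _).symm)
    simp only [map_zero] at h
    rw [Qrep', map_smul, h, smul_zero]
  symm i j := by
    rw [Qrep', Qrep', map_smul, map_smul, map_smul, swapWZ_scaleWZ,
      mkA2_scaleWZ_congr _ _ (hQ.symm i j), mul_comm]
  even i j hi := by
    rw [Qrep', map_smul, map_smul, map_smul, negW_scaleWZ,
      mkA2_scaleWZ_congr _ _ (hQ.even i j hi)]

theorem Qrep'_Qrep' {γ γinv : J → J → k} (hγ : ∀ i j, γ i j * γinv i j = 1)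
    (Q : J → J → FreeAlgebra k (Fin 2)) : Qrep' k J (Qrep' k J Q γ) γinv = Q := by
  ext1 i; ext1 j
  have h : γinv i j * γinv j i * (γ i j * γ j i) = 1 := by
    linear_combination (γ j i * γinv j i) * hγ i j + hγ j i
  rw [Qrep', Qrep', map_smul, scaleWZ_scaleWZ_of_mul_eq_one (hγ i i) (hγ j j), smul_smul, h,
    one_smul]

end Scaling

section Positions

variable {n}

@[simp]
theorem sperm_lo (a : Fin (n - 1)) : sperm a (lo a) = hi a := Equiv.swap_apply_left _ _

@[simp]
theorem sperm_hi (a : Fin (n - 1)) : sperm a (hi a) = lo a := Equiv.swap_apply_right _ _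

theorem sperm_of_ne {a : Fin (n - 1)} {p : Fin n} (h1 : p ≠ lo a) (h2 : p ≠ hi a) :
    sperm a p = p := Equiv.swap_apply_of_ne_of_ne h1 h2

end Positions

section Rescaling

variable {k I podd n} {Q : I → I → FreeAlgebra k (Fin 2)}

theorem mkAlgHom_xF (p : Fin n) :
    RingQuot.mkAlgHom k (RRel k I podd n Q) (xF k I n p) = xR k I podd n Q p := rfl

theorem mkAlgHom_tauF (a : Fin (n - 1)) :
    RingQuot.mkAlgHom k (RRel k I podd n Q) (tauF k I n a) = tauR k I podd n Q a := rfl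

theorem mkAlgHom_eF (ν : Fin n → I) :
    RingQuot.mkAlgHom k (RRel k I podd n Q) (eF k I n ν) = eR k I podd n Q ν := rfl

theorem eR_mul_eR_of_ne {μ ν : Fin n → I} (h : μ ≠ ν) :
    eR k I podd n Q μ * eR k I podd n Q ν = 0 := by
  simpa [eR] using RingQuot.mkAlgHom_rel k (RRel.e_orth (podd := podd) (Qrep := Q) μ ν h)

theorem eR_mul_eR_self (ν : Fin n → I) :
    eR k I podd n Q ν * eR k I podd n Q ν = eR k I podd n Q ν := by
  simpa [eR] using RingQuot.mkAlgHom_rel k (RRel.e_idem (podd := podd) (Qrep := Q) ν)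

theorem sum_eR : ∑ ν : Fin n → I, eR k I podd n Q ν = 1 := by
  simpa [eR] using
    RingQuot.mkAlgHom_rel k (RRel.e_sum (k := k) (n := n) (podd := podd) (Qrep := Q))

theorem xR_mul_eR (p : Fin n) (ν : Fin n → I) :
    xR k I podd n Q p * eR k I podd n Q ν = eR k I podd n Q ν * xR k I podd n Q p := by
  simpa [eR, xR] using RingQuot.mkAlgHom_rel k (RRel.xe (podd := podd) (Qrep := Q) p ν)

theorem tauR_mul_eR (a : Fin (n - 1)) (ν : Fin n → I) :
    tauR k I podd n Q a * eR k I podd n Q ν =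
      eR k I podd n Q (fun p => ν (sperm a p)) * tauR k I podd n Q a := by
  simpa [eR, tauR] using RingQuot.mkAlgHom_rel k (RRel.taue (podd := podd) (Qrep := Q) a ν)

/-- `m` lies in `e(ν) R_n(Q)`. -/
def HasWeight (ν : Fin n → I) (m : R k I podd n Q) : Prop := eR k I podd n Q ν * m = m

theorem hasWeight_eR (ν : Fin n → I) : HasWeight ν (eR k I podd n Q ν) := eR_mul_eR_self ν

theorem HasWeight.xR_mul {ν : Fin n → I} {m : R k I podd n Q} (h : HasWeight ν m) (p : Fin n) :
    HasWeight ν (xR k I podd n Q p * m) := by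
  rw [HasWeight, ← mul_assoc, ← xR_mul_eR, mul_assoc, h]

theorem HasWeight.tauR_mul {ν : Fin n → I} {m : R k I podd n Q} (h : HasWeight ν m)
    (a : Fin (n - 1)) : HasWeight (fun p => ν (sperm a p)) (tauR k I podd n Q a * m) := by
  rw [HasWeight, ← mul_assoc, ← tauR_mul_eR, mul_assoc, h]

variable (podd Q) in
/-- The rescaling map from the free algebra on the generators to `R_n(Q)`. -/
noncomputable def rescaleFree (γ γinv : I → I → k) : RFree k I n →ₐ[k] R k I podd n Q :=
  FreeAlgebra.lift k fun
    | .x p => ∑ ν : Fin n → I, γ (ν p) (ν p) • (xR k I podd n Q p * eR k I podd n Q ν)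
    | .tau a => ∑ ν : Fin n → I,
        γinv (ν (lo a)) (ν (hi a)) • (tauR k I podd n Q a * eR k I podd n Q ν)
    | .e ν => eR k I podd n Q ν

variable {γ γinv : I → I → k}

theorem rescaleFree_eF (ν : Fin n → I) :
    rescaleFree podd Q γ γinv (eF k I n ν) = eR k I podd n Q ν := by
  simp [rescaleFree, eF]

theorem rescaleFree_xF (p : Fin n) :
    rescaleFree podd Q γ γinv (xF k I n p) =
      ∑ ν : Fin n → I, γ (ν p) (ν p) • (xR k I podd n Q p * eR k I podd n Q ν) := by
  simp [rescaleFree, xF]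

theorem rescaleFree_tauF (a : Fin (n - 1)) :
    rescaleFree podd Q γ γinv (tauF k I n a) = ∑ ν : Fin n → I,
        γinv (ν (lo a)) (ν (hi a)) • (tauR k I podd n Q a * eR k I podd n Q ν) := by
  simp [rescaleFree, tauF]

/-- A weighted sum `∑ c_ν y e(ν)` acts on the weight space of `ν` as `c_ν y`. -/
theorem HasWeight.sum_smul_mul {ν : Fin n → I} {m : R k I podd n Q} (h : HasWeight ν m)
    (c : (Fin n → I) → k) (y : R k I podd n Q) :
    (∑ μ : Fin n → I, c μ • (y * eR k I podd n Q μ)) * m = c ν • (y * m) := by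
  rw [Finset.sum_mul, Finset.sum_eq_single ν]
  · rw [smul_mul_assoc, mul_assoc, h]
  · intro μ _ hμ
    rw [← h, smul_mul_assoc, mul_assoc, ← mul_assoc (eR k I podd n Q μ), eR_mul_eR_of_ne hμ]
    simp
  · simp

theorem HasWeight.rescaleFree_xF_mul {ν : Fin n → I} {m : R k I podd n Q} (h : HasWeight ν m)
    (p : Fin n) : rescaleFree podd Q γ γinv (xF k I n p) * m =
      γ (ν p) (ν p) • (xR k I podd n Q p * m) := by
  rw [rescaleFree_xF, h.sum_smul_mul fun ν => γ (ν p) (ν p)]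

theorem HasWeight.rescaleFree_tauF_mul {ν : Fin n → I} {m : R k I podd n Q}
    (h : HasWeight ν m) (a : Fin (n - 1)) : rescaleFree podd Q γ γinv (tauF k I n a) * m =
      γinv (ν (lo a)) (ν (hi a)) • (tauR k I podd n Q a * m) := by
  rw [rescaleFree_tauF, h.sum_smul_mul fun ν => γinv (ν (lo a)) (ν (hi a))]

theorem eR_mul_rescaleFree_xF (p : Fin n) (ν : Fin n → I) :
    eR k I podd n Q ν * rescaleFree podd Q γ γinv (xF k I n p) =
      γ (ν p) (ν p) • (xR k I podd n Q p * eR k I podd n Q ν) := by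
  rw [rescaleFree_xF, Finset.mul_sum, Finset.sum_eq_single ν]
  · rw [mul_smul_comm, ← mul_assoc, ← xR_mul_eR, mul_assoc, eR_mul_eR_self]
  · intro μ _ hμ
    rw [mul_smul_comm, ← mul_assoc, ← xR_mul_eR, mul_assoc, eR_mul_eR_of_ne hμ.symm]
    simp
  · simp

theorem eR_mul_rescaleFree_tauF (a : Fin (n - 1)) (ν : Fin n → I) :
    eR k I podd n Q (fun p => ν (sperm a p)) * rescaleFree podd Q γ γinv (tauF k I n a) =
      γinv (ν (lo a)) (ν (hi a)) • (tauR k I podd n Q a * eR k I podd n Q ν) := by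
  rw [rescaleFree_tauF, Finset.mul_sum, Finset.sum_eq_single ν]
  · rw [mul_smul_comm, ← mul_assoc, ← tauR_mul_eR, mul_assoc, eR_mul_eR_self]
  · intro μ _ hμ
    rw [mul_smul_comm, ← mul_assoc, ← tauR_mul_eR, mul_assoc, eR_mul_eR_of_ne hμ.symm]
    simp
  · simp

theorem HasWeight.lift_xF_mul {X : Type} (pos : X → Fin n) (u : FreeAlgebra k X)
    {ν : Fin n → I} {m : R k I podd n Q} (h : HasWeight ν m) :
    HasWeight ν (RingQuot.mkAlgHom k (RRel k I podd n Q)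
      (FreeAlgebra.lift k (fun t => xF k I n (pos t)) u) * m) := by
  induction u using FreeAlgebra.induction generalizing m with
  | grade0 r =>
    simp only [AlgHom.commutes]
    rw [HasWeight, ← Algebra.smul_def, mul_smul_comm, h]
  | grade1 t => simpa [xR] using h.xR_mul (pos t)
  | mul u v hu hv =>
    rw [map_mul, map_mul, mul_assoc]
    exact hu (hv h)
  | add u v hu hv =>
    have hu := hu h
    have hv := hv h
    rw [HasWeight] at hu hv ⊢
    rw [map_add, map_add, add_mul, mul_add, hu, hv]

/-- On the weight space of `ν`, the rescaling map turns a polynomial in the `x`'s into the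
polynomial with rescaled variables. -/
theorem HasWeight.rescaleFree_lift_xF_mul {X : Type} (pos : X → Fin n) (u : FreeAlgebra k X)
    {ν : Fin n → I} {m : R k I podd n Q} (h : HasWeight ν m) :
    rescaleFree podd Q γ γinv (FreeAlgebra.lift k (fun t => xF k I n (pos t)) u) * m =
      RingQuot.mkAlgHom k (RRel k I podd n Q) (FreeAlgebra.lift k (fun t => xF k I n (pos t))
        (scaleVars (fun t => γ (ν (pos t)) (ν (pos t))) u)) * m := by
  induction u using FreeAlgebra.induction generalizing m with
  | grade0 r => simp only [AlgHom.commutes]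
  | grade1 t =>
    rw [FreeAlgebra.lift_ι_apply, h.rescaleFree_xF_mul]
    simp [xR]
  | mul u v hu hv =>
    simp only [map_mul, mul_assoc]
    rw [hv h, hu (h.lift_xF_mul pos _)]
  | add u v hu hv => simp only [map_add, add_mul, hu h, hv h]

theorem HasWeight.rescaleFree_evalX_mul (a : Fin (n - 1)) (u : FreeAlgebra k (Fin 2))
    {ν : Fin n → I} {m : R k I podd n Q} (h : HasWeight ν m) :
    rescaleFree podd Q γ γinv (evalX k I n a u) * m =
      RingQuot.mkAlgHom k (RRel k I podd n Q) (evalX k I n a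
        (scaleWZ k (γ (ν (lo a)) (ν (lo a))) (γ (ν (hi a)) (ν (hi a))) u)) * m := by
  have hev : evalX k I n a =
      FreeAlgebra.lift k fun t => xF k I n (if t = 0 then lo a else hi a) := by
    ext t
    fin_cases t <;> simp [evalX]
  rw [hev, h.rescaleFree_lift_xF_mul, ← scaleWZ_eq_scaleVars]
  simp

theorem evalX3_eq_lift {K : Type} (a b : Fin (n - 1)) : evalX3 k K n a b =
    FreeAlgebra.lift k fun t =>
      xF k K n (if t = 0 then lo a else if t = 1 then hi a else hi b) := by
  ext t
  fin_cases t <;> simp [evalX3]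

/-- The scalars by which the variables at positions `a, a+1, a+2` are rescaled on the weight
space of `ν`. -/
def scalars3 (γ : I → I → k) (ν : Fin n → I) (a b : Fin (n - 1)) (t : Fin 3) : k :=
  γ (ν (if t = 0 then lo a else if t = 1 then hi a else hi b))
    (ν (if t = 0 then lo a else if t = 1 then hi a else hi b))

theorem HasWeight.rescaleFree_evalX3_mul (a b : Fin (n - 1)) (u : FreeAlgebra k (Fin 3))
    {ν : Fin n → I} {m : R k I podd n Q} (h : HasWeight ν m) :
    rescaleFree podd Q γ γinv (evalX3 k I n a b u) * m =
      RingQuot.mkAlgHom k (RRel k I podd n Q) (evalX3 k I n a b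
        (scaleVars (scalars3 γ ν a b) u)) * m := by
  rw [evalX3_eq_lift, h.rescaleFree_lift_xF_mul]
  rfl

theorem HasWeight.evalX3_mul (a b : Fin (n - 1)) (u : FreeAlgebra k (Fin 3))
    {ν : Fin n → I} {m : R k I podd n Q} (h : HasWeight ν m) :
    HasWeight ν (RingQuot.mkAlgHom k (RRel k I podd n Q) (evalX3 k I n a b u) * m) := by
  rw [evalX3_eq_lift]
  exact h.lift_xF_mul _ _

theorem rescaleFree_braid {a b : Fin (n - 1)} (hab : (b : ℕ) = (a : ℕ) + 1) (ν : Fin n → I) :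
    rescaleFree podd Q γ γinv
      (tauF k I n b * tauF k I n a * tauF k I n b * eF k I n ν
        - tauF k I n a * tauF k I n b * tauF k I n a * eF k I n ν) =
      (γinv (ν (lo a)) (ν (hi a)) * γinv (ν (lo a)) (ν (hi b)) * γinv (ν (hi a)) (ν (hi b))) •
        RingQuot.mkAlgHom k (RRel k I podd n Q)
          (tauF k I n b * tauF k I n a * tauF k I n b * eF k I n ν
            - tauF k I n a * tauF k I n b * tauF k I n a * eF k I n ν) := by
  have he := hasWeight_eR (k := k) (podd := podd) (Q := Q) ν
  have hlo : lo b = hi a := Fin.ext hab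
  have ha : sperm a (hi b) = hi b := by
    apply sperm_of_ne <;> simp only [lo, hi, ne_eq, Fin.mk.injEq] <;> omega
  have hb : sperm b (lo a) = lo a := by
    apply sperm_of_ne <;> simp only [lo, hi, ne_eq, Fin.mk.injEq] <;> omega
  have hb' : sperm b (hi a) = hi b := by rw [← hlo, sperm_lo]
  have hb'' : sperm b (hi b) = hi a := by rw [sperm_hi, hlo]
  simp only [map_mul, map_sub, mul_assoc, mkAlgHom_tauF, mkAlgHom_eF, rescaleFree_eF,
    he.rescaleFree_tauF_mul, mul_smul_comm, (he.tauR_mul _).rescaleFree_tauF_mul,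
    ((he.tauR_mul _).tauR_mul _).rescaleFree_tauF_mul, hlo, ha, hb, hb', hb'', sperm_lo, sperm_hi,
    smul_sub, smul_smul]
  congr 2
  ring

variable {Q' : I → I → FreeAlgebra k (Fin 2)}

theorem rescaleFree_rel (hQ' : Q' = Qrep' k I Q γ) (hγ : ∀ i j, γ i j * γinv i j = 1)
    {u v : RFree k I n} (huv : RRel k I podd n Q u v) :
    rescaleFree podd Q' γ γinv u = rescaleFree podd Q' γ γinv v := by
  cases huv with
  | e_orth μ ν h => simp only [map_mul, map_zero, rescaleFree_eF, eR_mul_eR_of_ne h]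
  | e_idem ν => simp only [map_mul, rescaleFree_eF, eR_mul_eR_self]
  | e_sum => simp only [map_sum, map_one, rescaleFree_eF, sum_eR]
  | xe p ν =>
    simp only [map_mul, rescaleFree_eF, eR_mul_rescaleFree_xF,
      (hasWeight_eR ν).rescaleFree_xF_mul]
  | taue a ν =>
    simp only [map_mul, rescaleFree_eF, eR_mul_rescaleFree_tauF,
      (hasWeight_eR ν).rescaleFree_tauF_mul]
  | xx p q ν =>
    have hrel := RingQuot.mkAlgHom_rel k (RRel.xx (k := k) (podd := podd) (Qrep := Q') p q ν)
    have he := hasWeight_eR (k := k) (podd := podd) (Q := Q') ν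
    split_ifs at hrel ⊢ <;>
      simp only [map_mul, map_neg, mul_assoc, mkAlgHom_xF, mkAlgHom_eF, rescaleFree_eF,
        he.rescaleFree_xF_mul, mul_smul_comm, (he.xR_mul _).rescaleFree_xF_mul] at hrel ⊢ <;>
      rw [hrel, smul_comm]
    simp only [smul_neg]
  | taux a p ν h1 h2 =>
    have hrel := RingQuot.mkAlgHom_rel k
      (RRel.taux (k := k) (podd := podd) (Qrep := Q') a p ν h1 h2)
    have he := hasWeight_eR (k := k) (podd := podd) (Q := Q') ν
    split_ifs at hrel ⊢ <;>
      simp only [map_mul, map_neg, mul_assoc, mkAlgHom_xF, mkAlgHom_tauF, mkAlgHom_eF,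
        rescaleFree_eF, he.rescaleFree_xF_mul,
        he.rescaleFree_tauF_mul, mul_smul_comm, (he.xR_mul _).rescaleFree_tauF_mul,
        (he.tauR_mul _).rescaleFree_xF_mul, sperm_of_ne h1 h2] at hrel ⊢ <;>
      rw [hrel, smul_comm]
    simp only [smul_neg]
  | taux1 a ν =>
    have hrel := RingQuot.mkAlgHom_rel k (RRel.taux1 (k := k) (podd := podd) (Qrep := Q') a ν)
    have he := hasWeight_eR (k := k) (podd := podd) (Q := Q') ν
    have hs : rescaleFree podd Q' γ γinv (if ν (lo a) = ν (hi a) then eF k I n ν else 0) =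
        (γ (ν (hi a)) (ν (hi a)) * γinv (ν (lo a)) (ν (hi a))) •
          (if ν (lo a) = ν (hi a) then eR k I podd n Q' ν else 0) := by
      split_ifs with h
      · rw [h, hγ, one_smul, rescaleFree_eF]
      · rw [smul_zero, map_zero]
    rw [hs]
    have hm := congrArg (fun y => (γ (ν (hi a)) (ν (hi a)) * γinv (ν (lo a)) (ν (hi a))) • y) hrel
    rw [apply_ite (RingQuot.mkAlgHom k (RRel k I podd n Q')), map_zero, mkAlgHom_eF] at hm
    rw [← hm]
    split_ifs <;>
      simp only [map_mul, map_neg, map_sub, mul_assoc, mkAlgHom_xF, mkAlgHom_tauF, mkAlgHom_eF,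
        rescaleFree_eF, he.rescaleFree_xF_mul, he.rescaleFree_tauF_mul, mul_smul_comm,
        (he.xR_mul _).rescaleFree_tauF_mul, (he.tauR_mul _).rescaleFree_xF_mul, sperm_lo,
        smul_sub, smul_neg, mul_smul] <;>
      simp only [smul_comm (γ (ν (hi a)) (ν (hi a))) (γinv _ _)]
  | taux2 a ν =>
    have hrel := RingQuot.mkAlgHom_rel k (RRel.taux2 (k := k) (podd := podd) (Qrep := Q') a ν)
    have he := hasWeight_eR (k := k) (podd := podd) (Q := Q') ν
    have hs : rescaleFree podd Q' γ γinv (if ν (lo a) = ν (hi a) then eF k I n ν else 0) =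
        (γ (ν (lo a)) (ν (lo a)) * γinv (ν (lo a)) (ν (hi a))) •
          (if ν (lo a) = ν (hi a) then eR k I podd n Q' ν else 0) := by
      split_ifs with h
      · rw [h, hγ, one_smul, rescaleFree_eF]
      · rw [smul_zero, map_zero]
    rw [hs]
    have hm := congrArg (fun y => (γ (ν (lo a)) (ν (lo a)) * γinv (ν (lo a)) (ν (hi a))) • y) hrel
    rw [apply_ite (RingQuot.mkAlgHom k (RRel k I podd n Q')), map_zero, mkAlgHom_eF] at hm
    rw [← hm]
    split_ifs <;>
      simp only [map_mul, map_neg, map_sub, mul_assoc, mkAlgHom_xF, mkAlgHom_tauF, mkAlgHom_eF,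
        rescaleFree_eF, he.rescaleFree_xF_mul, he.rescaleFree_tauF_mul, mul_smul_comm,
        (he.xR_mul _).rescaleFree_tauF_mul, (he.tauR_mul _).rescaleFree_xF_mul, sperm_hi,
        smul_sub, smul_neg, mul_smul] <;>
      simp only [smul_comm (γ (ν (lo a)) (ν (lo a))) (γinv _ _)]
  | tausq a ν =>
    have hrel := RingQuot.mkAlgHom_rel k (RRel.tausq (k := k) (podd := podd) (Qrep := Q') a ν)
    have he := hasWeight_eR (k := k) (podd := podd) (Q := Q') ν
    have hc : γinv (ν (lo a)) (ν (hi a)) * γinv (ν (hi a)) (ν (lo a)) *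
        (γ (ν (lo a)) (ν (hi a)) * γ (ν (hi a)) (ν (lo a))) = 1 := by
      linear_combination (γ (ν (hi a)) (ν (lo a)) * γinv (ν (hi a)) (ν (lo a))) *
        hγ (ν (lo a)) (ν (hi a)) + hγ (ν (hi a)) (ν (lo a))
    simp only [map_mul, mul_assoc, mkAlgHom_tauF, mkAlgHom_eF] at hrel
    simp only [map_mul, mul_assoc, rescaleFree_eF, he.rescaleFree_tauF_mul, mul_smul_comm,
      (he.tauR_mul _).rescaleFree_tauF_mul, sperm_lo, sperm_hi, he.rescaleFree_evalX_mul]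
    rw [hrel, hQ', Qrep', map_smul, map_smul, smul_mul_assoc, smul_smul, smul_smul, hc, one_smul]
  | tautau a b ν h =>
    have hrel := RingQuot.mkAlgHom_rel k
      (RRel.tautau (k := k) (podd := podd) (Qrep := Q') a b ν h)
    have he := hasWeight_eR (k := k) (podd := podd) (Q := Q') ν
    have hab : lo a ≠ lo b ∧ lo a ≠ hi b ∧ hi a ≠ lo b ∧ hi a ≠ hi b := by
      simp only [lo, hi, ne_eq, Fin.mk.injEq]
      omega
    obtain ⟨h1, h2, h3, h4⟩ := hab
    split_ifs at hrel ⊢ <;>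
      simp only [map_mul, map_neg, mul_assoc, mkAlgHom_tauF, mkAlgHom_eF, rescaleFree_eF,
        he.rescaleFree_tauF_mul, mul_smul_comm, (he.tauR_mul _).rescaleFree_tauF_mul,
        sperm_of_ne h1 h2, sperm_of_ne h3 h4, sperm_of_ne h1.symm h3.symm,
        sperm_of_ne h2.symm h4.symm] at hrel ⊢ <;>
      rw [hrel, smul_comm]
    simp only [smul_neg]
  | braid_even a b hab ν hsame hev D hD =>
    have h2 : scalars3 γ ν a b 2 = γ (ν (lo a)) (ν (lo a)) := by rw [hsame]; rfl
    have hd : scaleVars (scalars3 γ ν a b)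
        (FreeAlgebra.ι k (2 : Fin 3) - FreeAlgebra.ι k (0 : Fin 3)) =
        γ (ν (lo a)) (ν (lo a)) • (FreeAlgebra.ι k (2 : Fin 3) - FreeAlgebra.ι k (0 : Fin 3)) := by
      rw [map_sub, scaleVars_ι, scaleVars_ι, h2, smul_sub]
      rfl
    have hrel := RingQuot.mkAlgHom_rel k (RRel.braid_even (k := k) (podd := podd) (Qrep := Q')
      a b hab ν hsame hev _ (hQ' ▸
        mkA3_dividedDifference (γ := γ) (i := ν (lo a)) (j := ν (hi a))
          (c := scalars3 γ ν a b) rfl rfl h2 hd hD))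
    have he := hasWeight_eR (k := k) (podd := podd) (Q := Q') ν
    rw [rescaleFree_braid hab, hrel]
    simp only [map_mul, map_smul, rescaleFree_eF, he.rescaleFree_evalX3_mul, mkAlgHom_eF,
      smul_mul_assoc, smul_smul]
    rw [← hsame, braid_scalar hγ, one_smul]
  | braid_odd a b hab ν hsame hodd D hD =>
    have h2 : scalars3 γ ν a b 2 = γ (ν (lo a)) (ν (lo a)) := by rw [hsame]; rfl
    have hd : scaleVars (scalars3 γ ν a b)
        (FreeAlgebra.ι k (2 : Fin 3) * FreeAlgebra.ι k (2 : Fin 3)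
          - FreeAlgebra.ι k (0 : Fin 3) * FreeAlgebra.ι k (0 : Fin 3)) =
        (γ (ν (lo a)) (ν (lo a)) * γ (ν (lo a)) (ν (lo a))) •
          (FreeAlgebra.ι k (2 : Fin 3) * FreeAlgebra.ι k (2 : Fin 3)
            - FreeAlgebra.ι k (0 : Fin 3) * FreeAlgebra.ι k (0 : Fin 3)) := by
      rw [map_sub, map_mul, map_mul, scaleVars_ι, scaleVars_ι, h2, smul_mul_smul_comm,
        smul_mul_smul_comm, smul_sub]
      rfl
    have hrel := RingQuot.mkAlgHom_rel k (RRel.braid_odd (k := k) (podd := podd) (Qrep := Q')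
      a b hab ν hsame hodd _ (hQ' ▸
        mkA3_dividedDifference (γ := γ) (i := ν (lo a)) (j := ν (hi a))
          (c := scalars3 γ ν a b) rfl rfl h2 hd hD))
    have he := hasWeight_eR (k := k) (podd := podd) (Q := Q') ν
    have hr : rescaleFree podd Q' γ γinv
        ((xF k I n (hi b) - xF k I n (lo a)) * evalX3 k I n a b D * eF k I n ν) =
        (γinv (ν (lo a)) (ν (hi a)) * γinv (ν (lo a)) (ν (hi b)) * γinv (ν (hi a)) (ν (hi b))) •
        RingQuot.mkAlgHom k (RRel k I podd n Q')
        ((xF k I n (hi b) - xF k I n (lo a)) * evalX3 k I n a b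
          ((γ (ν (lo a)) (ν (hi a)) * γ (ν (hi a)) (ν (lo a)) *
            (γ (ν (lo a)) (ν (lo a)) * γ (ν (lo a)) (ν (lo a)))) •
              scaleVars (scalars3 γ ν a b) D) * eF k I n ν) := by
      simp only [map_mul, map_smul, map_sub, mul_assoc, rescaleFree_eF, he.rescaleFree_evalX3_mul,
        mkAlgHom_eF, mkAlgHom_xF, sub_mul, (he.evalX3_mul a b _).rescaleFree_xF_mul,
        smul_mul_assoc, mul_smul_comm, smul_sub, smul_smul]
      rw [← hsame]
      congr 2 <;>
        linear_combination -γ (ν (lo a)) (ν (lo a)) * braid_scalar hγ (ν (lo a)) (ν (hi a))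
    rw [rescaleFree_braid hab, hrel]
    split_ifs
    · rw [map_neg, map_neg, smul_neg, hr]
    · rw [hr]
  | braid_zero a b hab ν hdiff =>
    rw [rescaleFree_braid hab, RingQuot.mkAlgHom_rel k
      (RRel.braid_zero (k := k) (podd := podd) (Qrep := Q') a b hab ν hdiff), map_zero, map_zero,
      smul_zero]

variable (podd n) in
/-- The rescaling homomorphism `R_n(Q) → R_n(Q')`. -/
noncomputable def rescaleHom (hQ' : Q' = Qrep' k I Q γ) (hγ : ∀ i j, γ i j * γinv i j = 1) :
    R k I podd n Q →ₐ[k] R k I podd n Q' :=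
  RingQuot.liftAlgHom k ⟨rescaleFree podd Q' γ γinv, fun {_ _} h => rescaleFree_rel hQ' hγ h⟩

section Hom

variable (hQ' : Q' = Qrep' k I Q γ) (hγ : ∀ i j, γ i j * γinv i j = 1)

theorem rescaleHom_mkAlgHom (u : RFree k I n) :
    rescaleHom podd n hQ' hγ (RingQuot.mkAlgHom k (RRel k I podd n Q) u) =
      rescaleFree podd Q' γ γinv u :=
  RingQuot.liftAlgHom_mkAlgHom_apply k _ _ u

theorem rescaleHom_eR (ν : Fin n → I) :
    rescaleHom podd n hQ' hγ (eR k I podd n Q ν) = eR k I podd n Q' ν := by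
  rw [eR, rescaleHom_mkAlgHom, rescaleFree_eF]

theorem rescaleHom_xR_mul_eR (p : Fin n) (ν : Fin n → I) :
    rescaleHom podd n hQ' hγ (xR k I podd n Q p * eR k I podd n Q ν) =
      γ (ν p) (ν p) • (xR k I podd n Q' p * eR k I podd n Q' ν) := by
  rw [map_mul, rescaleHom_eR, xR, rescaleHom_mkAlgHom, (hasWeight_eR ν).rescaleFree_xF_mul]

theorem rescaleHom_tauR_mul_eR (a : Fin (n - 1)) (ν : Fin n → I) :
    rescaleHom podd n hQ' hγ (tauR k I podd n Q a * eR k I podd n Q ν) =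
      γinv (ν (lo a)) (ν (hi a)) • (tauR k I podd n Q' a * eR k I podd n Q' ν) := by
  rw [map_mul, rescaleHom_eR, tauR, rescaleHom_mkAlgHom,
    (hasWeight_eR ν).rescaleFree_tauF_mul]

theorem rescaleHom_comp_rescaleHom (hQ : Q = Qrep' k I Q' γinv)
    (hγ' : ∀ i j, γinv i j * γ i j = 1) :
    (rescaleHom podd n hQ hγ').comp (rescaleHom podd n hQ' hγ) = AlgHom.id k _ := by
  apply RingQuot.ringQuot_ext'
  ext g
  simp only [Function.comp_apply, AlgHom.comp_apply, AlgHom.id_apply, rescaleHom_mkAlgHom]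
  cases g with
  | x p =>
    change rescaleHom podd n hQ hγ' (rescaleFree podd Q' γ γinv (xF k I n p)) =
      xR k I podd n Q p
    simp only [rescaleFree_xF, map_sum, map_smul, rescaleHom_xR_mul_eR, smul_smul, hγ, one_smul]
    rw [← Finset.mul_sum, sum_eR, mul_one]
  | tau a =>
    change rescaleHom podd n hQ hγ' (rescaleFree podd Q' γ γinv (tauF k I n a)) =
      tauR k I podd n Q a
    simp only [rescaleFree_tauF, map_sum, map_smul, rescaleHom_tauR_mul_eR, smul_smul, hγ',
      one_smul]
    rw [← Finset.mul_sum, sum_eR, mul_one]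
  | e ν =>
    change rescaleHom podd n hQ hγ' (rescaleFree podd Q' γ γinv (eF k I n ν)) =
      eR k I podd n Q ν
    rw [rescaleFree_eF, rescaleHom_eR]

end Hom

end Rescaling

theorem rescaling_isomorphism [Invertible (2 : k)]
    (Qrep : I → I → FreeAlgebra k (Fin 2)) (hQ : QConds k I podd Qrep)
    (γ γinv : I → I → k) (hγ : ∀ i j, γ i j * γinv i j = 1) :
    QConds k I podd (Qrep' k I Qrep γ) ∧
    ∃ F : R k I podd n Qrep ≃ₐ[k] R k I podd n (Qrep' k I Qrep γ),
      (∀ ν : Fin n → I,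
        F (eR k I podd n Qrep ν) = eR k I podd n (Qrep' k I Qrep γ) ν) ∧
      (∀ (p : Fin n) (ν : Fin n → I),
        F (xR k I podd n Qrep p * eR k I podd n Qrep ν) =
          γ (ν p) (ν p) •
            (xR k I podd n (Qrep' k I Qrep γ) p * eR k I podd n (Qrep' k I Qrep γ) ν)) ∧
      (∀ (a : Fin (n - 1)) (ν : Fin n → I),
        F (tauR k I podd n Qrep a * eR k I podd n Qrep ν) =
          γinv (ν (lo a)) (ν (hi a)) •
            (tauR k I podd n (Qrep' k I Qrep γ) a * eR k I podd n (Qrep' k I Qrep γ) ν)) := by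
  have hγ' : ∀ i j, γinv i j * γ i j = 1 := fun i j => (mul_comm _ _).trans (hγ i j)
  have hQ'' := (Qrep'_Qrep' hγ Qrep).symm
  exact ⟨hQ.rescale γ,
    AlgEquiv.ofAlgHom (rescaleHom podd n rfl hγ) (rescaleHom podd n hQ'' hγ')
      (rescaleHom_comp_rescaleHom hQ'' hγ' rfl hγ) (rescaleHom_comp_rescaleHom rfl hγ hQ'' hγ'),
    rescaleHom_eR rfl hγ, rescaleHom_xR_mul_eR rfl hγ, rescaleHom_tauR_mul_eR rfl hγ⟩

end QuiverHeckeSuper11
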